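/- Let X be a probabilistic coherence space and let dig_X ∈ (ℝ≥0)^{Mfin(|X|)×Mfin(Mfin(|X|))} be the digging matrix, defined by (dig_X)_{m,[m₁,…,mₙ]} = 1 if m₁ + … + mₙ = m (multiset sum) and 0 otherwise. For v ∈ P(!X), let v^! ∈ (ℝ≥0)^{Mfin(Mfin(|X|))} be its promotion, v^!_M = Π_{m} v_m^{M(m)}. Then for every v ∈ P(!X): dig_X·v = v^! if and only if there exists u ∈ P(X) with v = u^!. In other words, the coalgebraic elements of !X are exactly the promotions {u^! : u ∈ P(X)}. -/

import Mathlib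

open scoped ENNReal NNReal Classical

noncomputable section

namespace PCS

variable {I J K : Type*}

/-- Pairing `⟨u,u'⟩ = Σ_a u_a u'_a`, valued in `[0,∞]`. -/
def pair (u u' : I → ℝ≥0) : ℝ≥0∞ := ∑' a, (u a : ℝ≥0∞) * (u' a : ℝ≥0∞)

/-- Orthogonal of a set of nonnegative families. -/
def orth (F : Set (I → ℝ≥0)) : Set (I → ℝ≥0) := {u' | ∀ u ∈ F, pair u u' ≤ 1}

/-- `P` is (the set of vectors of) a probabilistic coherence space on the web `I`. -/
structure IsPCS (P : Set (I → ℝ≥0)) : Prop where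
  biorth : orth (orth P) = P
  pos : ∀ a : I, ∃ u ∈ P, 0 < u a
  bdd : ∀ a : I, ∃ A : ℝ≥0, 0 < A ∧ ∀ u ∈ P, u a ≤ A

/-- Application of a matrix to a vector: `(t·u)_b = Σ_a t_{a,b} u_a ∈ [0,∞]`. -/
def matApp (t : I × J → ℝ≥0) (u : I → ℝ≥0) : J → ℝ≥0∞ :=
  fun b => ∑' a, (t (a, b) : ℝ≥0∞) * (u a : ℝ≥0∞)

/-- Application for `[0,∞]`-valued matrices/vectors. -/
def matAppE (t : I × J → ℝ≥0∞) (u : I → ℝ≥0∞) : J → ℝ≥0∞ :=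
  fun b => ∑' a, t (a, b) * u a

/-- A `[0,∞]`-valued vector belongs to `Q ⊆ (ℝ≥0)^J` if it is pointwise the coercion of
an element of `Q` (in particular it is everywhere finite). -/
def memP (Q : Set (J → ℝ≥0)) (v : J → ℝ≥0∞) : Prop :=
  ∃ w ∈ Q, ∀ b, v b = (w b : ℝ≥0∞)

/-- `t` is a morphism from `(I,P)` to `(J,Q)`: `t·u ∈ Q` for every `u ∈ P`. -/
def IsMorphism (t : I × J → ℝ≥0) (P : Set (I → ℝ≥0)) (Q : Set (J → ℝ≥0)) : Prop :=
  ∀ u ∈ P, memP Q (matApp t u)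

/-- Matrix composition `(t ∘ s)_{a,c} = Σ_b s_{a,b} t_{b,c}`, in `[0,∞]`. -/
def matComp (s : I × J → ℝ≥0) (t : J × K → ℝ≥0) : I × K → ℝ≥0∞ :=
  fun p => ∑' b, (s (p.1, b) : ℝ≥0∞) * (t (b, p.2) : ℝ≥0∞)

/-- Composition of `[0,∞]`-valued matrices. -/
def matCompE (s : I × J → ℝ≥0∞) (t : J × K → ℝ≥0∞) : I × K → ℝ≥0∞ :=
  fun p => ∑' b, s (p.1, b) * t (b, p.2)

/-- Set of simple tensors `u⊗v` with `u ∈ P`, `v ∈ Q`. -/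
def tensSet (P : Set (I → ℝ≥0)) (Q : Set (J → ℝ≥0)) : Set (I × J → ℝ≥0) :=
  {w | ∃ u ∈ P, ∃ v ∈ Q, w = fun p => u p.1 * v p.2}

/-- `P(X⊗Y)`: biorthogonal closure of the simple tensors. -/
def tensorP (P : Set (I → ℝ≥0)) (Q : Set (J → ℝ≥0)) : Set (I × J → ℝ≥0) :=
  orth (orth (tensSet P Q))

/-- `P(X⊸Y) = P((X ⊗ Y⊥)⊥)`. -/
def limplP (P : Set (I → ℝ≥0)) (Q : Set (J → ℝ≥0)) : Set (I × J → ℝ≥0) :=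
  orth (tensorP P (orth Q))

/-- Norm `‖u‖_X = sup{⟨u,u'⟩ : u' ∈ P(X)⊥}`. -/
def normE (P : Set (I → ℝ≥0)) (u : I → ℝ≥0) : ℝ≥0∞ :=
  ⨆ u' ∈ orth P, pair u u'

/-- The product `&_{i} X_i`. -/
def withP {ι : Type*} {A : ι → Type*} (P : ∀ i, Set (A i → ℝ≥0)) :
    Set ((Σ i, A i) → ℝ≥0) :=
  {u | ∀ i, (fun a => u ⟨i, a⟩) ∈ P i}

/-- The coproduct `⊕_{i} X_i = (&_{i} X_i⊥)⊥`. -/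
def plusP {ι : Type*} {A : ι → Type*} (P : ∀ i, Set (A i → ℝ≥0)) :
    Set ((Σ i, A i) → ℝ≥0) :=
  orth (withP fun i => orth (P i))

/-- Projection matrix `π_i`. -/
def projMat {ι : Type*} {A : ι → Type*} (i : ι) : ((Σ j, A j) × A i) → ℝ≥0 :=
  fun p => if p.1 = ⟨i, p.2⟩ then 1 else 0

/-- Injection matrix `in_j`. -/
def injMat {ι : Type*} {A : ι → Type*} (j : ι) : (A j × Σ i, A i) → ℝ≥0 :=
  fun p => if p.2 = ⟨j, p.1⟩ then 1 else 0

/-- `u^m = Π_a u_a^{m(a)}`. -/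
def mpow (u : I → ℝ≥0) (m : Multiset I) : ℝ≥0 := (m.map u).prod

/-- `v^m` for `[0,∞]`-valued `v`. -/
def mpowE (v : I → ℝ≥0∞) (m : Multiset I) : ℝ≥0∞ := (m.map v).prod

/-- Promotion `u^! = (u^m)_m`. -/
def promote (u : I → ℝ≥0) : Multiset I → ℝ≥0 := fun m => mpow u m

/-- `P(!X)`: biorthogonal closure of the promotions. -/
def bangP (P : Set (I → ℝ≥0)) : Set (Multiset I → ℝ≥0) :=
  orth (orth {v | ∃ u ∈ P, v = promote u})

/-- The function associated with a matrix `s ∈ (ℝ≥0)^{Mfin(I)×J}`: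
`ŝ(u)_b = Σ_m s_{m,b} u^m`. -/
def fhat (s : Multiset I × J → ℝ≥0) (u : I → ℝ≥0) : J → ℝ≥0∞ :=
  fun b => ∑' m : Multiset I, (s (m, b) : ℝ≥0∞) * (mpow u m : ℝ≥0∞)

/-- Factorial of a multiset: `m! = Π_a m(a)!`. -/
def mfact [DecidableEq I] (m : Multiset I) : ℕ :=
  (m.dedup.map fun a => (m.count a).factorial).prod

/-- Multisets over `I × J` with first marginal `c` and second marginal `d`. -/
def marg (c : Multiset I) (d : Multiset J) : Set (Multiset (I × J)) :=
  {r | r.map Prod.fst = c ∧ r.map Prod.snd = d}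

/-- The exponential of a matrix: `(!t)_{c,d} = Σ_{r ∈ L(c,d)} (d!/r!) t^r`. -/
def bangMatE [DecidableEq I] [DecidableEq J] (t : I × J → ℝ≥0∞) :
    Multiset I × Multiset J → ℝ≥0∞ :=
  fun p => ∑' r : marg p.1 p.2,
    ((mfact p.2 : ℝ≥0∞) / (mfact r.1 : ℝ≥0∞)) * mpowE t r.1

theorem pair_extend_zero {f : J → I} (hf : Function.Injective f) (w : I → ℝ≥0) (u' : J → ℝ≥0) :
    pair w (Function.extend f u' 0) = pair (w ∘ f) u' := by
  unfold pair
  rw [← hf.tsum_eq]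
  · simp [hf.extend_apply]
  · intro i hi
    by_contra h
    exact hi (by simp [Function.extend_apply' _ _ _ h])

theorem pair_comm (u u' : I → ℝ≥0) : pair u u' = pair u' u := by
  simp only [pair, mul_comm]

theorem promote_comp_singleton (u : I → ℝ≥0) : promote u ∘ (fun a => ({a} : Multiset I)) = u := by
  funext a
  simp [promote, mpow]

/-- The restriction of an element of `P(!X)` to the singleton multisets lies in `P(X)`. -/
theorem comp_singleton_mem_of_mem_bangP {P : Set (I → ℝ≥0)} (hP : IsPCS P)
    {v : Multiset I → ℝ≥0} (hv : v ∈ bangP P) : v ∘ (fun a => ({a} : Multiset I)) ∈ P := by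
  rw [← hP.biorth]
  intro u' hu'
  rw [pair_comm, ← pair_extend_zero (fun _ _ => Multiset.singleton_inj.1), pair_comm]
  refine hv _ ?_
  rintro _ ⟨u, hu, rfl⟩
  rw [pair_extend_zero (fun _ _ => Multiset.singleton_inj.1), promote_comp_singleton]
  exact hu' u hu

theorem matApp_dig (v : Multiset I → ℝ≥0) (M : Multiset (Multiset I)) :
    matApp
        (fun p : Multiset I × Multiset (Multiset I) =>
          if p.2.sum = p.1 then (1 : ℝ≥0) else 0)
        v M
      = v M.sum := by
  unfold matApp
  rw [tsum_eq_single M.sum]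
  · simp
  · intro m hm
    simp [hm.symm]

theorem mpowE_coe (v : I → ℝ≥0) (m : Multiset I) :
    mpowE (fun a => (v a : ℝ≥0∞)) m = mpow v m := by
  induction m using Multiset.induction_on with
  | empty => simp [mpowE, mpow]
  | cons a m ih => simp_all [mpowE, mpow]

theorem promote_sum (u : I → ℝ≥0) (M : Multiset (Multiset I)) :
    promote u M.sum = mpow (promote u) M := by
  induction M using Multiset.induction_on with
  | empty => simp [promote, mpow]
  | cons a m ih => simp_all [promote, mpow]

/-- The coalgebraic elements of `!X` (those satisfying `dig·v = v^!`) are exactly the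
promotions of elements of `P(X)`. -/
theorem coalgebraic_bang {I : Type*} [Countable I] (P : Set (I → ℝ≥0)) (hP : IsPCS P) :
    ∀ v ∈ bangP P,
      ((∀ M : Multiset (Multiset I),
          matApp
              (fun p : Multiset I × Multiset (Multiset I) =>
                if p.2.sum = p.1 then (1 : ℝ≥0) else 0)
              v M
            = mpowE (fun m => (v m : ℝ≥0∞)) M) ↔
        ∃ u ∈ P, v = promote u) := by
  intro v hv
  simp only [matApp_dig, mpowE_coe, ENNReal.coe_inj]
  constructor
  · intro h
    refine ⟨_, comp_singleton_mem_of_mem_bangP hP hv, ?_⟩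
    funext m
    have hm := h (m.map fun a => {a})
    rw [Multiset.sum_map_singleton] at hm
    simpa [promote, mpow, Multiset.map_map] using hm
  · rintro ⟨u, -, rfl⟩ M
    exact promote_sum u M

end PCS
end
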